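/- Let a, b, c be pairwise distinct elements of ℂ ∖ {0,1}; set u₁ = 1 + u + v, v₁ = a + b·u + c·v, A₁ = (b−z)/(b−c), B₁ = (c−z)/(c−b), a₁ = (a−b)/(b−c), b₁ = (a−c)/(c−b), and P(z) = z(z−1)·A₁B₁(A₁b₁ − B₁a₁). Then the affine surface S: w³·u₁v₁(v₁−u₁) = u·v (coordinates (w,u,v)) is birationally equivalent to the affine surface S₂: w₁³·P(z) = t₃(t₃+1) (coordinates (z,t₃,w₁)): there is a ℂ-algebra isomorphism of their function fields intertwining the order-3 automorphism w ↦ ω²·w of Frac(S) with the order-3 automorphism w₁ ↦ ω²·w₁ of Frac(S₂) (each fixing the remaining coordinates). -/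

import Mathlib

/-!
Formalization conventions.

* The function field of an affine variety whose coordinate ring `ℂ[x₁,…,xₙ]/I` is an
  integral domain is formalized as `FractionRing` of that coordinate ring (for the total
  rings of fractions of the rings appearing here this is the function field).
* Two such varieties are birationally equivalent iff their function fields are
  isomorphic as `ℂ`-algebras.
-/

noncomputable section
open MvPolynomial

/-- `ω = exp(2πi/3) ∈ ℂ`, a fixed primitive cube root of unity. -/
def ω : ℂ := Complex.exp (2 * Real.pi * Complex.I / 3)

/-- Coordinate ring of the affine hypersurface `f = 0` in `ℂⁿ`. -/
abbrev HSurf {n : ℕ} (f : MvPolynomial (Fin n) ℂ) : Type :=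
  MvPolynomial (Fin n) ℂ ⧸ Ideal.span {f}

/-- Coordinate ring of the affine variety `f = g = 0` in `ℂⁿ`. -/
abbrev HSurf2 {n : ℕ} (f g : MvPolynomial (Fin n) ℂ) : Type :=
  MvPolynomial (Fin n) ℂ ⧸ Ideal.span {f, g}

/-- The image of a polynomial `p` in the function field of the hypersurface `f = 0`. -/
def cls {n : ℕ} (f : MvPolynomial (Fin n) ℂ) (p : MvPolynomial (Fin n) ℂ) :
    FractionRing (HSurf f) :=
  algebraMap (HSurf f) (FractionRing (HSurf f)) (Ideal.Quotient.mk _ p)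

/-- The image of a polynomial `p` in the function field of the variety `f = g = 0`. -/
def cls2 {n : ℕ} (f g : MvPolynomial (Fin n) ℂ) (p : MvPolynomial (Fin n) ℂ) :
    FractionRing (HSurf2 f g) :=
  algebraMap (HSurf2 f g) (FractionRing (HSurf2 f g)) (Ideal.Quotient.mk _ p)

/-- `u₁ = 1 + u + v` in the coordinates of `S` (`w = X 0`, `u = X 1`, `v = X 2`). -/
def u₁S : MvPolynomial (Fin 3) ℂ := 1 + X 1 + X 2

/-- `v₁ = a + b·u + c·v`. -/
def v₁S (a b c : ℂ) : MvPolynomial (Fin 3) ℂ := C a + C b * X 1 + C c * X 2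

/-- Defining polynomial of the affine surface `S : w³·u₁v₁(v₁−u₁) = u·v`. -/
def pS (a b c : ℂ) : MvPolynomial (Fin 3) ℂ :=
  X 0 ^ 3 * u₁S * v₁S a b c * (v₁S a b c - u₁S) - X 1 * X 2

/-- The constant `a₁ = (a−b)/(b−c)`. -/
def a₁ (a b c : ℂ) : ℂ := (a - b) / (b - c)

/-- The constant `b₁ = (a−c)/(c−b)`. -/
def b₁ (a b c : ℂ) : ℂ := (a - c) / (c - b)

/-- `A₁ = (b−z)/(b−c)` in the coordinates of `S₂` (`z = X 0`, `t₃ = X 1`, `w₁ = X 2`). -/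
def A₁' (b c : ℂ) : MvPolynomial (Fin 3) ℂ := C (b - c)⁻¹ * (C b - X 0)

/-- `B₁ = (c−z)/(c−b)`. -/
def B₁' (b c : ℂ) : MvPolynomial (Fin 3) ℂ := C (c - b)⁻¹ * (C c - X 0)

/-- Defining polynomial of the affine surface `S₂ : w₁³·P(z) = t₃(t₃+1)`, where
`P(z) = z(z−1)·A₁B₁(A₁b₁ − B₁a₁)`. -/
def pS₂ (a b c : ℂ) : MvPolynomial (Fin 3) ℂ :=
  X 2 ^ 3 * (X 0 * (X 0 - 1) * A₁' b c * B₁' b c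
      * (A₁' b c * C (b₁ a b c) - B₁' b c * C (a₁ a b c)))
    - X 1 * (X 1 + 1)

theorem eis_irred {R : Type*} [CommRing R] [IsDomain R] (L p q : R) (hp : Prime p) (hq : Prime q)
    (hpL : ¬ p ∣ L) (hqL : ¬ q ∣ L) (hpq : ¬ p ∣ q) :
    Irreducible (Polynomial.C L * Polynomial.X ^ 3 - Polynomial.C (p * q)) := by
  have hL : L ≠ 0 := by rintro rfl; exact hpL (dvd_zero _)
  have hdeg : (Polynomial.C L * Polynomial.X ^ 3 - Polynomial.C (p * q)).degree = 3 := by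
    compute_degree!
  have hnd := Polynomial.natDegree_eq_of_degree_eq_some hdeg
  refine Polynomial.irreducible_of_eisenstein_criterion (P := Ideal.span {p})
    ((Ideal.span_singleton_prime hp.ne_zero).2 hp) ?_ ?_ ?_ ?_ ?_
  · rw [Polynomial.leadingCoeff, hnd, Ideal.mem_span_singleton]
    simpa [Polynomial.coeff_C] using hpL
  · intro n hn
    rw [hdeg] at hn
    have hn : n < 3 := by exact_mod_cast hn
    rw [Ideal.mem_span_singleton]
    interval_cases n <;> simp [Polynomial.coeff_C, Polynomial.coeff_X_pow]
  · rw [hdeg]; norm_num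
  · rw [Ideal.span_singleton_pow, Ideal.mem_span_singleton]
    simp only [Polynomial.coeff_sub, Polynomial.coeff_C_mul, Polynomial.coeff_X_pow]
    simp only [Polynomial.coeff_C]
    simp
    rw [pow_two]
    intro h
    exact hpq ((mul_dvd_mul_iff_left hp.ne_zero).1 h)
  · intro r hr
    rw [Polynomial.C_dvd_iff_dvd_coeff] at hr
    have h3 : r ∣ L := by simpa [Polynomial.coeff_C] using hr 3
    have h0 : r ∣ p * q := by simpa [Polynomial.coeff_C] using hr 0
    obtain ⟨s, hs⟩ := h0
    have hps : p ∣ s := by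
      rcases hp.dvd_or_dvd (Dvd.intro _ hs) with h | h
      · exact absurd (h.trans h3) hpL
      · exact h
    obtain ⟨s', rfl⟩ := hps
    have hs' : q = r * s' := by
      apply mul_left_cancel₀ hp.ne_zero; rw [hs]; ring
    rcases hq.dvd_or_dvd (Dvd.intro _ hs'.symm |>.trans (dvd_refl _) |> fun _ => (hs' ▸ dvd_refl q : q ∣ r * s')) with h | h
    · exact absurd (h.trans h3) hqL
    · obtain ⟨s'', rfl⟩ := h
      refine IsUnit.of_mul_eq_one s'' ?_
      apply mul_left_cancel₀ hq.ne_zero; rw [mul_one]; nth_rewrite 2 [hs']; ring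

theorem not_dvd_of_eval {σ : Type*} (x : σ → ℂ) (p q : MvPolynomial σ ℂ) (hp : eval x p = 0)
    (hq : eval x q ≠ 0) : ¬ p ∣ q := by
  rintro ⟨r, rfl⟩
  simp [hp] at hq

theorem isDomain_of_prime (f : MvPolynomial (Fin 3) ℂ) (hf : Prime f) : IsDomain (HSurf f) := by
  have := (Ideal.span_singleton_prime hf.ne_zero).2 hf
  infer_instance

theorem prime_pS (a b c : ℂ) (ha0 : a ≠ 0) (ha1 : a ≠ 1) : Prime (pS a b c) := by
  rw [← MulEquiv.prime_iff (finSuccEquiv ℂ 2)]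
  have : finSuccEquiv ℂ 2 (pS a b c) =
      Polynomial.C ((1 + X 0 + X 1) * (C a + C b * X 0 + C c * X 1) *
        ((C a + C b * X 0 + C c * X 1) - (1 + X 0 + X 1))) * Polynomial.X ^ 3 -
      Polynomial.C (X 0 * X 1) := by
    have e1 : finSuccEquiv ℂ 2 (X 1) = Polynomial.C (X 0) := finSuccEquiv_X_succ (j := 0)
    have e2 : finSuccEquiv ℂ 2 (X 2) = Polynomial.C (X 1) := finSuccEquiv_X_succ (j := 1)
    have e3 (r : ℂ) : finSuccEquiv ℂ 2 (C r) = Polynomial.C (C r) := by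
      simp [finSuccEquiv_apply]
    simp only [pS, u₁S, v₁S, map_sub, map_mul, map_add, map_pow, map_one, e1, e2, e3,
      finSuccEquiv_X_zero]
    ring
  rw [this]
  have h1 : a - 1 ≠ 0 := sub_ne_zero.2 ha1
  refine (eis_irred _ _ _ (X_prime) (X_prime) ?_ ?_ ?_).prime
  · exact not_dvd_of_eval (fun _ => 0) _ _ (by simp) (by simp [ha0, h1])
  · exact not_dvd_of_eval (fun _ => 0) _ _ (by simp) (by simp [ha0, h1])
  · exact not_dvd_of_eval ![0, 1] _ _ (by simp) (by simp)

theorem prime_X_add_one : Prime (X 0 + 1 : MvPolynomial (Fin 2) ℂ) := by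
  have h : Prime (X 0 : MvPolynomial (Fin 2) ℂ) := X_prime
  let f : MvPolynomial (Fin 2) ℂ →ₐ[ℂ] MvPolynomial (Fin 2) ℂ := aeval ![X 0 + 1, X 1]
  let g : MvPolynomial (Fin 2) ℂ →ₐ[ℂ] MvPolynomial (Fin 2) ℂ := aeval ![X 0 - 1, X 1]
  let e : MvPolynomial (Fin 2) ℂ ≃ₐ[ℂ] MvPolynomial (Fin 2) ℂ :=
    AlgEquiv.ofAlgHom f g (by ext i; fin_cases i <;> simp [f, g])
      (by ext i; fin_cases i <;> simp [f, g])
  have := (MulEquiv.prime_iff e).2 h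
  simpa [e, f] using this

theorem prime_pS₂ (a b c : ℂ) (hbc : b ≠ c) (z : ℂ) (hz0 : z ≠ 0) (hz1 : z ≠ 1)
    (hza : z ≠ a) (hzb : z ≠ b) (hzc : z ≠ c) : Prime (pS₂ a b c) := by
  rw [← MulEquiv.prime_iff (renameEquiv ℂ (Equiv.swap (0 : Fin 3) 2)),
    ← MulEquiv.prime_iff (finSuccEquiv ℂ 2)]
  have s0 : (Equiv.swap (0 : Fin 3) 2) 0 = 2 := by decide
  have s1 : (Equiv.swap (0 : Fin 3) 2) 1 = 1 := by decide
  have s2 : (Equiv.swap (0 : Fin 3) 2) 2 = 0 := by decide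
  have : finSuccEquiv ℂ 2 (renameEquiv ℂ (Equiv.swap (0 : Fin 3) 2) (pS₂ a b c)) =
      Polynomial.C (X 1 * (X 1 - 1) * (C (b - c)⁻¹ * (C b - X 1)) * (C (c - b)⁻¹ * (C c - X 1))
      * ((C (b - c)⁻¹ * (C b - X 1)) * C (b₁ a b c) - (C (c - b)⁻¹ * (C c - X 1)) * C (a₁ a b c)))
       * Polynomial.X ^ 3 -
      Polynomial.C (X 0 * (X 0 + 1)) := by
    have e1 : finSuccEquiv ℂ 2 (X 1) = Polynomial.C (X 0) := finSuccEquiv_X_succ (j := 0)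
    have e2 : finSuccEquiv ℂ 2 (X 2) = Polynomial.C (X 1) := finSuccEquiv_X_succ (j := 1)
    have e3 (r : ℂ) : finSuccEquiv ℂ 2 (C r) = Polynomial.C (C r) := by
      simp [finSuccEquiv_apply]
    simp only [pS₂, A₁', B₁', renameEquiv_apply, rename_X, rename_C, map_sub, map_mul, map_add, map_pow, map_one, e1, e2, e3,
      finSuccEquiv_X_zero, s0, s1, s2]
    ring
  rw [this]
  have hbc' := sub_ne_zero.2 hbc
  have hcb' := sub_ne_zero.2 hbc.symm
  have key : z * (z - 1) * ((b - c)⁻¹ * (b - z)) * ((c - b)⁻¹ * (c - z))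
      * (((b - c)⁻¹ * (b - z)) * b₁ a b c - ((c - b)⁻¹ * (c - z)) * a₁ a b c) ≠ 0 := by
    have : ((b - c)⁻¹ * (b - z)) * b₁ a b c - ((c - b)⁻¹ * (c - z)) * a₁ a b c
      = (z - a) / (b - c) := by
      have : c - b = - (b - c) := by ring
      rw [b₁, a₁, this]; field_simp; ring
    rw [this]
    simp only [ne_eq, mul_eq_zero, inv_eq_zero, div_eq_zero_iff, not_or, sub_eq_zero]
    refine ⟨⟨⟨⟨hz0, hz1⟩, hbc, hzb.symm⟩, hbc.symm, hzc.symm⟩, hza, hbc⟩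
  refine (eis_irred _ _ _ (X_prime) prime_X_add_one ?_ ?_ ?_).prime
  · refine not_dvd_of_eval ![0, z] _ _ (by simp) ?_
    simpa using key
  · refine not_dvd_of_eval ![-1, z] _ _ (by simp) ?_
    simpa using key
  · exact not_dvd_of_eval ![0, 1] _ _ (by simp) (by simp)

theorem cls_ne_zero (f p : MvPolynomial (Fin 3) ℂ) [IsDomain (HSurf f)] (x : Fin 3 → ℂ)
    (hf : eval x f = 0) (hp : eval x p ≠ 0) : cls f p ≠ 0 := by
  intro h
  rw [cls, map_eq_zero_iff _ (IsFractionRing.injective (HSurf f) (FractionRing (HSurf f))),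
    Ideal.Quotient.eq_zero_iff_mem, Ideal.mem_span_singleton] at h
  exact not_dvd_of_eval x f p hf hp h

/-- `cls` as an algebra homomorphism. -/
def clsHom (f : MvPolynomial (Fin 3) ℂ) : MvPolynomial (Fin 3) ℂ →ₐ[ℂ] FractionRing (HSurf f) :=
  (IsScalarTower.toAlgHom ℂ (HSurf f) (FractionRing (HSurf f))).comp
    (Ideal.Quotient.mkₐ ℂ (Ideal.span {f}))

theorem clsHom_apply (f p : MvPolynomial (Fin 3) ℂ) : clsHom f p = cls f p := rfl

theorem clsHom_self (f : MvPolynomial (Fin 3) ℂ) : clsHom f f = 0 := by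
  rw [clsHom_apply, cls, Ideal.Quotient.eq_zero_iff_mem.2 (Ideal.mem_span_singleton_self f),
    map_zero]

theorem frac_ext (f : MvPolynomial (Fin 3) ℂ) {L : Type*} [CommRing L] [Algebra ℂ L]
    (F G : FractionRing (HSurf f) →ₐ[ℂ] L)
    (h : ∀ i, F (cls f (X i)) = G (cls f (X i))) : F = G := by
  have h1 : F.comp (clsHom f) = G.comp (clsHom f) := by
    apply MvPolynomial.algHom_ext
    exact h
  apply AlgHom.coe_ringHom_injective
  apply IsLocalization.ringHom_ext (nonZeroDivisors (HSurf f))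
  apply Ideal.Quotient.ringHom_ext
  apply MvPolynomial.ringHom_ext
  · intro r; exact (F.commutes r).trans (G.commutes r).symm
  · exact h

theorem main_equiv (f g : MvPolynomial (Fin 3) ℂ) [IsDomain (HSurf f)] [IsDomain (HSurf g)]
    (x : Fin 3 → FractionRing (HSurf g)) (hx : aeval x f = 0)
    (y : Fin 3 → FractionRing (HSurf f)) (hy : aeval y g = 0)
    (n d N D : Fin 3 → MvPolynomial (Fin 3) ℂ)
    (hd : ∀ i, aeval y (d i) ≠ 0)
    (h1 : ∀ i, clsHom g (d i) * x i = clsHom g (n i))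
    (h2 : ∀ i, aeval y (d i) * clsHom f (X i) = aeval y (n i))
    (hD : ∀ i, clsHom f (D i) ≠ 0)
    (h3 : ∀ i, clsHom f (D i) * y i = clsHom f (N i))
    (h4 : ∀ i, aeval x (D i) * clsHom g (X i) = aeval x (N i)) :
    ∃ φ : FractionRing (HSurf f) ≃ₐ[ℂ] FractionRing (HSurf g),
      (∀ i, φ (cls f (X i)) = x i) ∧ (∀ i, φ (y i) = cls g (X i)) := by
  have hyg (p : MvPolynomial (Fin 3) ℂ) (hp : clsHom g p = 0) : aeval y p = 0 := by
    rw [clsHom_apply, cls,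
      map_eq_zero_iff _ (IsFractionRing.injective (HSurf g) (FractionRing (HSurf g))),
      Ideal.Quotient.eq_zero_iff_mem, Ideal.mem_span_singleton] at hp
    obtain ⟨r, rfl⟩ := hp
    simp [hy]
  have key (p : MvPolynomial (Fin 3) ℂ) : ∃ m e : MvPolynomial (Fin 3) ℂ, aeval y e ≠ 0 ∧
      clsHom g e * aeval x p = clsHom g m ∧ aeval y e * clsHom f p = aeval y m := by
    induction p using MvPolynomial.induction_on with
    | C r => exact ⟨C r, 1, by simp, by simp [← MvPolynomial.algebraMap_eq], by simp [← MvPolynomial.algebraMap_eq]⟩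
    | add p q hp hq =>
      obtain ⟨m, e, h, h', h''⟩ := hp
      obtain ⟨m2, e2, k, k', k''⟩ := hq
      refine ⟨m * e2 + m2 * e, e * e2, by simp [h, k], ?_, ?_⟩
      · simp only [map_mul, map_add]
        linear_combination (clsHom g e2) * h' + clsHom g e * k'
      · simp only [map_mul, map_add]
        linear_combination (aeval y e2) * h'' + aeval y e * k''
    | mul_X p i hp =>
      obtain ⟨m, e, h, h', h''⟩ := hp
      refine ⟨m * n i, e * d i, by simp [h, hd], ?_, ?_⟩
      · simp only [map_mul, aeval_X]
        rw [← h', ← h1 i]; ring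
      · simp only [map_mul]
        rw [← h'', ← h2 i]; ring
  have key2 (p : MvPolynomial (Fin 3) ℂ) (hp : aeval x p = 0) : clsHom f p = 0 := by
    obtain ⟨m, e, h, h', h''⟩ := key p
    rw [hp, mul_zero] at h'
    rw [hyg m h'.symm] at h''
    exact (mul_eq_zero.1 h'').resolve_left h
  let F0 : HSurf f →ₐ[ℂ] FractionRing (HSurf g) :=
    Ideal.Quotient.liftₐ (Ideal.span {f}) (aeval x) (by
      intro p hp
      rw [Ideal.mem_span_singleton] at hp
      obtain ⟨r, rfl⟩ := hp
      simp [hx])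
  have hF0 (p : MvPolynomial (Fin 3) ℂ) : F0 (Ideal.Quotient.mk _ p) = aeval x p := rfl
  have hinj : Function.Injective F0 := by
    rw [injective_iff_map_eq_zero]
    intro q hq
    obtain ⟨p, rfl⟩ := Ideal.Quotient.mk_surjective q
    have := key2 p hq
    rwa [clsHom_apply, cls,
      map_eq_zero_iff _ (IsFractionRing.injective (HSurf f) (FractionRing (HSurf f)))] at this
  let F : FractionRing (HSurf f) →ₐ[ℂ] FractionRing (HSurf g) := IsFractionRing.liftAlgHom hinj
  have hF (p : MvPolynomial (Fin 3) ℂ) : F (clsHom f p) = aeval x p := by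
    rw [← hF0, clsHom_apply, cls]
    exact IsFractionRing.lift_algebraMap hinj _
  have hFy (i) : F (y i) = clsHom g (X i) := by
    have a1 := congrArg F (h3 i)
    rw [map_mul, hF, hF, ← h4 i] at a1
    refine mul_left_cancel₀ ?_ a1
    rw [← hF]
    exact fun h => hD i ((map_eq_zero_iff F F.toRingHom.injective).1 h)
  have hFg (p : MvPolynomial (Fin 3) ℂ) : F (aeval y p) = clsHom g p := by
    have : F.comp (aeval y) = clsHom g := by
      ext i; simp [hFy]
    exact DFunLike.congr_fun this p
  have hsurj : Function.Surjective F := by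
    intro q
    obtain ⟨s, t, ht, rfl⟩ := IsFractionRing.div_surjective (A := HSurf g) q
    obtain ⟨s, rfl⟩ := Ideal.Quotient.mk_surjective s
    obtain ⟨t, rfl⟩ := Ideal.Quotient.mk_surjective t
    refine ⟨aeval y s / aeval y t, ?_⟩
    rw [map_div₀, hFg, hFg]; rfl
  refine ⟨AlgEquiv.ofBijective F ⟨F.toRingHom.injective, hsurj⟩, ?_, ?_⟩
  · intro i
    have := hF (X i)
    rw [aeval_X] at this
    exact this
  · exact hFy

theorem omega_prim : IsPrimitiveRoot ω 3 := by
  have := Complex.isPrimitiveRoot_exp 3 (by norm_num)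
  simpa [ω] using this

theorem aeval_pS {K : Type*} [Field K] [Algebra ℂ K] (a b c : ℂ) (x : Fin 3 → K) :
    aeval x (pS a b c) = x 0 ^ 3 * (1 + x 1 + x 2) *
      (algebraMap ℂ K a + algebraMap ℂ K b * x 1 + algebraMap ℂ K c * x 2) *
      ((algebraMap ℂ K a + algebraMap ℂ K b * x 1 + algebraMap ℂ K c * x 2) - (1 + x 1 + x 2)) -
      x 1 * x 2 := by
  simp [pS, u₁S, v₁S]

theorem aeval_pS₂ {K : Type*} [Field K] [Algebra ℂ K] (a b c : ℂ) (hbc : b ≠ c) (x : Fin 3 → K) :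
    aeval x (pS₂ a b c) = x 2 ^ 3 * (x 0 * (x 0 - 1) *
      (algebraMap ℂ K b - x 0) * (x 0 - algebraMap ℂ K c) * (x 0 - algebraMap ℂ K a)) /
      (algebraMap ℂ K b - algebraMap ℂ K c) ^ 3 -
      x 1 * (x 1 + 1) := by
  have h : algebraMap ℂ K b - algebraMap ℂ K c ≠ 0 :=
    sub_ne_zero.2 fun h => hbc ((algebraMap ℂ K).injective h)
  have h' : algebraMap ℂ K c - algebraMap ℂ K b = - (algebraMap ℂ K b - algebraMap ℂ K c) := by ring
  simp only [pS₂, A₁', B₁', a₁, b₁, map_sub, map_mul, map_add, map_pow, map_one, aeval_X, aeval_C,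
    map_inv₀, map_div₀, h']
  field_simp
  ring

theorem alg_one {K : Type*} [Field K] (a b c W U V : K) (hbc : b - c ≠ 0)
    (h : W ^ 3 * (1 + U + V) * (a + b * U + c * V) * ((a + b * U + c * V) - (1 + U + V))
      - U * V = 0)
    (hu : 1 + U + V ≠ 0) (hv : (a + b * U + c * V) - a * (1 + U + V) ≠ 0) (z t w : K)
    (hz : (1 + U + V) * z = a + b * U + c * V)
    (ht : ((a + b * U + c * V) - a * (1 + U + V)) * t =
      ((a + b * U + c * V) - c * (1 + U + V)) * V)
    (hw : ((a + b * U + c * V) - a * (1 + U + V)) * w = (b - c) * W * (1 + U + V) ^ 2) :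
    w ^ 3 * (z * (z - 1) * (b - z) * (z - c) * (z - a)) / (b - c) ^ 3 - t * (t + 1) = 0 := by
  have ht1 : ((a + b * U + c * V) - a * (1 + U + V)) * (t + 1) =
      (b * (1 + U + V) - (a + b * U + c * V)) * U := by
    rw [mul_add, ht]; ring
  generalize hs : 1 + U + V = s at *
  generalize hr : a + b * U + c * V = r at *
  obtain rfl : z = r / s := by rw [eq_div_iff hu]; linear_combination hz
  obtain rfl : w = (b - c) * W * s ^ 2 / (r - a * s) := by
    rw [eq_div_iff hv]; linear_combination hw
  have e : t + 1 = (b * s - r) * U / (r - a * s) := by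
    rw [eq_div_iff hv]; linear_combination ht1
  rw [e]
  obtain rfl : t = (r - c * s) * V / (r - a * s) := by
    rw [eq_div_iff hv]; linear_combination ht
  field_simp
  linear_combination (b * s - r) * (r - c * s) / (r - a * s) ^ 2 * h

theorem alg_two {K : Type*} [Field K] (a b c z t w : K) (hbc : b - c ≠ 0)
    (h : w ^ 3 * (z * (z - 1) * (b - z) * (z - c) * (z - a)) / (b - c) ^ 3 - t * (t + 1) = 0)
    (hzb : b - z ≠ 0) (hzc : z - c ≠ 0)
    (hE : (z - c) * (b - a) + (z - a) * t * (b - c) ≠ 0) (W U V : K)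
    (hU : (b - z) * U = (z - a) * (t + 1)) (hV : (z - c) * V = (z - a) * t)
    (hW : (b - c) * ((z - c) * (b - a) + (z - a) * t * (b - c)) * W =
      w * (z - a) * (b - z) * (z - c)) :
    W ^ 3 * (1 + U + V) * (a + b * U + c * V) * ((a + b * U + c * V) - (1 + U + V))
      - U * V = 0 := by
  have hs : (b - z) * (z - c) * (1 + U + V) = (z - c) * (b - a) + (z - a) * t * (b - c) := by
    linear_combination (z - c) * hU + (b - z) * hV
  have hr : a + b * U + c * V = z * (1 + U + V) := by
    linear_combination hU - hV
  rw [hr]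
  rw [← hs] at hW hE
  have hs0 : 1 + U + V ≠ 0 := right_ne_zero_of_mul hE
  generalize 1 + U + V = s at *
  have hW' : (b - c) * s * W = w * (z - a) := by
    apply mul_left_cancel₀ (mul_ne_zero hzb hzc)
    linear_combination hW
  obtain rfl : W = w * (z - a) / ((b - c) * s) := by
    rw [eq_div_iff (mul_ne_zero hbc hs0)]; linear_combination hW'
  obtain rfl : U = (z - a) * (t + 1) / (b - z) := by
    rw [eq_div_iff hzb]; linear_combination hU
  obtain rfl : V = (z - a) * t / (z - c) := by
    rw [eq_div_iff hzc]; linear_combination hV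
  have h2 : w ^ 3 * (z * (z - 1) * (b - z) * (z - c) * (z - a)) = (b - c) ^ 3 * (t * (t + 1)) := by
    rw [sub_eq_zero, div_eq_iff (pow_ne_zero 3 hbc)] at h
    rw [h]; ring
  clear hU hV hW hW' hs hr h
  field_simp
  linear_combination (z - a) ^ 2 * h2

theorem aeval_clsHom (f p : MvPolynomial (Fin 3) ℂ) :
    aeval (fun i => clsHom f (X i)) p = clsHom f p := by
  exact (DFunLike.congr_fun (MvPolynomial.aeval_unique (clsHom f)) p).symm

theorem clsHom_C (f : MvPolynomial (Fin 3) ℂ) (r : ℂ) :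
    clsHom f (C r) = algebraMap ℂ _ r := (clsHom f).commutes r

theorem sigma_exists (a b c : ℂ) [IsDomain (HSurf (pS a b c))] :
    ∃ σ : FractionRing (HSurf (pS a b c)) ≃ₐ[ℂ] FractionRing (HSurf (pS a b c)),
      σ (cls (pS a b c) (X 0)) = (ω ^ 2 : ℂ) • cls (pS a b c) (X 0) ∧
      σ (cls (pS a b c) (X 1)) = cls (pS a b c) (X 1) ∧
      σ (cls (pS a b c) (X 2)) = cls (pS a b c) (X 2) := by
  have hω : ω ^ 3 = 1 := omega_prim.pow_eq_one
  have hK : (algebraMap ℂ (FractionRing (HSurf (pS a b c))) ω) ^ 3 = 1 := by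
    rw [← map_pow, hω, map_one]
  have h0 := clsHom_self (pS a b c)
  rw [← aeval_clsHom, aeval_pS] at h0
  obtain ⟨φ, hφ, -⟩ := main_equiv (pS a b c) (pS a b c)
    ![algebraMap ℂ _ ω ^ 2 * clsHom (pS a b c) (X 0), clsHom (pS a b c) (X 1),
      clsHom (pS a b c) (X 2)] (by
        rw [aeval_pS]
        simp only [Matrix.cons_val]
        rw [← h0, mul_pow, ← pow_mul, mul_comm 2 3, pow_mul, hK]; ring)
    ![algebraMap ℂ _ ω * clsHom (pS a b c) (X 0), clsHom (pS a b c) (X 1),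
      clsHom (pS a b c) (X 2)] (by
        rw [aeval_pS]
        simp only [Matrix.cons_val]
        rw [← h0, mul_pow, hK]; ring)
    ![C ω ^ 2 * X 0, X 1, X 2] (fun _ => 1) ![C ω * X 0, X 1, X 2] (fun _ => 1)
    (by simp)
    (by intro i; fin_cases i <;> simp [clsHom_C])
    (by
      intro i
      fin_cases i
      · simp
        linear_combination (- clsHom (pS a b c) (X 0)) * hK
      · simp
      · simp)
    (by simp)
    (by intro i; fin_cases i <;> simp [clsHom_C])
    (by
      intro i
      fin_cases i
      · simp
        linear_combination (- clsHom (pS a b c) (X 0)) * hK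
      · simp
      · simp)
  refine ⟨φ, ?_, ?_, ?_⟩
  · rw [hφ, Algebra.smul_def, map_pow]; rfl
  · rw [hφ]; rfl
  · rw [hφ]; rfl

theorem sigma_order (a b c : ℂ) [IsDomain (HSurf (pS a b c))]
    (σ : FractionRing (HSurf (pS a b c)) ≃ₐ[ℂ] FractionRing (HSurf (pS a b c)))
    (h0 : σ (cls (pS a b c) (X 0)) = (ω ^ 2 : ℂ) • cls (pS a b c) (X 0))
    (h1 : σ (cls (pS a b c) (X 1)) = cls (pS a b c) (X 1))
    (h2 : σ (cls (pS a b c) (X 2)) = cls (pS a b c) (X 2))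
    (hX : cls (pS a b c) (X 0) ≠ 0) : orderOf σ = 3 := by
  have hω : ω ^ 3 = 1 := omega_prim.pow_eq_one
  have : Fact (Nat.Prime 3) := ⟨Nat.prime_three⟩
  apply orderOf_eq_prime
  · have : (σ ^ 3 : _ ≃ₐ[ℂ] _).toAlgHom = AlgHom.id ℂ _ := by
      apply frac_ext
      intro i
      change σ (σ (σ _)) = _
      fin_cases i
      · simp only [Fin.zero_eta, h0, map_smul, smul_smul, AlgHom.id_apply]
        rw [show ω ^ 2 * ω ^ 2 * ω ^ 2 = (ω ^ 3) ^ 2 by ring, hω]; simp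
      · simp [h1]
      · simp [h2]
    ext k
    exact DFunLike.congr_fun this k
  · rintro rfl
    have h : (ω ^ 2 - 1 : ℂ) • cls (pS a b c) (X 0) = 0 := by
      rw [sub_smul, ← h0]; simp
    rcases smul_eq_zero.1 h with h | h
    · exact omega_prim.pow_ne_one_of_pos_of_lt (by norm_num) (by norm_num) (sub_eq_zero.1 h)
    · exact hX h

set_option maxHeartbeats 4000000 in
theorem phi_exists (a b c : ℂ) (hab : a ≠ b) (hac : a ≠ c) (hbc : b ≠ c)
    [IsDomain (HSurf (pS a b c))] [IsDomain (HSurf (pS₂ a b c))] :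
    ∃ (φ : FractionRing (HSurf (pS a b c)) ≃ₐ[ℂ] FractionRing (HSurf (pS₂ a b c)))
      (y : Fin 3 → FractionRing (HSurf (pS a b c))),
      (∀ i, φ (y i) = cls (pS₂ a b c) (X i)) ∧
      (∀ σ : FractionRing (HSurf (pS a b c)) ≃ₐ[ℂ] FractionRing (HSurf (pS a b c)),
        σ (cls (pS a b c) (X 0)) = (ω ^ 2 : ℂ) • cls (pS a b c) (X 0) →
        σ (cls (pS a b c) (X 1)) = cls (pS a b c) (X 1) →
        σ (cls (pS a b c) (X 2)) = cls (pS a b c) (X 2) →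
        σ (y 0) = y 0 ∧ σ (y 1) = y 1 ∧ σ (y 2) = (ω ^ 2 : ℂ) • y 2) := by
  have hK := clsHom_self (pS a b c)
  rw [← aeval_clsHom, aeval_pS] at hK
  have hL := clsHom_self (pS₂ a b c)
  rw [← aeval_clsHom, aeval_pS₂ a b c hbc] at hL
  have hab' := sub_ne_zero.2 hab
  have hba' := sub_ne_zero.2 hab.symm
  have hac' := sub_ne_zero.2 hac
  have hca' := sub_ne_zero.2 hac.symm
  have hbcK : algebraMap ℂ (FractionRing (HSurf (pS a b c))) b - algebraMap ℂ _ c ≠ 0 :=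
    sub_ne_zero.2 fun h => hbc ((algebraMap ℂ _).injective h)
  have hbcL : algebraMap ℂ (FractionRing (HSurf (pS₂ a b c))) b - algebraMap ℂ _ c ≠ 0 :=
    sub_ne_zero.2 fun h => hbc ((algebraMap ℂ _).injective h)
  -- nonvanishing on `S`
  have e0 : eval (fun _ => 0) (pS a b c) = 0 := by simp [pS]
  have e1 : eval ![0, 0, 1] (pS a b c) = 0 := by simp [pS]
  have k1 := cls_ne_zero (pS a b c) u₁S (fun _ => 0) e0 (by simp [u₁S])
  have k2 := cls_ne_zero (pS a b c) (v₁S a b c - C c * u₁S) (fun _ => 0) e0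
    (by simpa [u₁S, v₁S] using hac')
  have k3 := cls_ne_zero (pS a b c) (C b * u₁S - v₁S a b c) (fun _ => 0) e0
    (by simpa [u₁S, v₁S] using hba')
  have k4 := cls_ne_zero (pS a b c) (v₁S a b c - C a * u₁S) ![0, 0, 1] e1
    (by simp [u₁S, v₁S]; intro h; apply hca'; linear_combination h)
  -- nonvanishing on `S₂`
  have e2 : eval ![a, 0, 0] (pS₂ a b c) = 0 := by simp [pS₂]
  have l1 := cls_ne_zero (pS₂ a b c) (C b - X 0) _ e2 (by simpa using hba')
  have l2 := cls_ne_zero (pS₂ a b c) (X 0 - C c) _ e2 (by simpa using hac')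
  have l3 := cls_ne_zero (pS₂ a b c)
    ((X 0 - C c) * (C b - C a) + (X 0 - C a) * X 1 * (C b - C c)) _ e2
    (by simpa using ⟨hac', hba'⟩)
  simp only [← clsHom_apply, u₁S, v₁S, map_sub, map_mul, map_add, map_one, clsHom_C]
    at k1 k2 k3 k4 l1 l2 l3
  set W := clsHom (pS a b c) (X 0) with hWdef
  set U := clsHom (pS a b c) (X 1) with hUdef
  set V := clsHom (pS a b c) (X 2) with hVdef
  set z := clsHom (pS₂ a b c) (X 0) with hzdef
  set t := clsHom (pS₂ a b c) (X 1) with htdef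
  set w := clsHom (pS₂ a b c) (X 2) with hwdef
  let aK := algebraMap ℂ (FractionRing (HSurf (pS a b c))) a
  let bK := algebraMap ℂ (FractionRing (HSurf (pS a b c))) b
  let cK := algebraMap ℂ (FractionRing (HSurf (pS a b c))) c
  let aL := algebraMap ℂ (FractionRing (HSurf (pS₂ a b c))) a
  let bL := algebraMap ℂ (FractionRing (HSurf (pS₂ a b c))) b
  let cL := algebraMap ℂ (FractionRing (HSurf (pS₂ a b c))) c
  change 1 + U + V ≠ 0 at k1
  change (aK + bK * U + cK * V) - cK * (1 + U + V) ≠ 0 at k2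
  change bK * (1 + U + V) - (aK + bK * U + cK * V) ≠ 0 at k3
  change (aK + bK * U + cK * V) - aK * (1 + U + V) ≠ 0 at k4
  change bL - z ≠ 0 at l1
  change z - cL ≠ 0 at l2
  change (z - cL) * (bL - aL) + (z - aL) * t * (bL - cL) ≠ 0 at l3
  change bK - cK ≠ 0 at hbcK
  change bL - cL ≠ 0 at hbcL
  -- the coordinates
  obtain ⟨y0, hy0⟩ : ∃ q, q = (aK + bK * U + cK * V) / (1 + U + V) := ⟨_, rfl⟩
  obtain ⟨y1, hy1⟩ : ∃ q, q = ((aK + bK * U + cK * V) - cK * (1 + U + V)) * V /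
    ((aK + bK * U + cK * V) - aK * (1 + U + V)) := ⟨_, rfl⟩
  obtain ⟨y2, hy2⟩ : ∃ q, q = (bK - cK) * W * (1 + U + V) ^ 2 /
    ((aK + bK * U + cK * V) - aK * (1 + U + V)) := ⟨_, rfl⟩
  obtain ⟨x0, hx0⟩ : ∃ q, q = w * (z - aL) * (bL - z) * (z - cL) /
    ((bL - cL) * ((z - cL) * (bL - aL) + (z - aL) * t * (bL - cL))) := ⟨_, rfl⟩
  obtain ⟨x1, hx1⟩ : ∃ q, q = (z - aL) * (t + 1) / (bL - z) := ⟨_, rfl⟩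
  obtain ⟨x2, hx2⟩ : ∃ q, q = (z - aL) * t / (z - cL) := ⟨_, rfl⟩
  have gy0 : (1 + U + V) * y0 = aK + bK * U + cK * V := by rw [hy0, mul_div_cancel₀ _ k1]
  have gy1 : ((aK + bK * U + cK * V) - aK * (1 + U + V)) * y1 =
      ((aK + bK * U + cK * V) - cK * (1 + U + V)) * V := by rw [hy1, mul_div_cancel₀ _ k4]
  have gy2 : ((aK + bK * U + cK * V) - aK * (1 + U + V)) * y2 =
      (bK - cK) * W * (1 + U + V) ^ 2 := by rw [hy2, mul_div_cancel₀ _ k4]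
  have gx0 : (bL - cL) * ((z - cL) * (bL - aL) + (z - aL) * t * (bL - cL)) * x0 =
      w * (z - aL) * (bL - z) * (z - cL) := by
    rw [hx0, mul_div_cancel₀ _ (mul_ne_zero hbcL l3)]
  have gx1 : (bL - z) * x1 = (z - aL) * (t + 1) := by rw [hx1, mul_div_cancel₀ _ l1]
  have gx2 : (z - cL) * x2 = (z - aL) * t := by rw [hx2, mul_div_cancel₀ _ l2]
  have hX := alg_two aL bL cL z t w hbcL hL l1 l2 l3 x0 x1 x2 gx1 gx2 gx0
  have hY := alg_one aK bK cK W U V hbcK hK k1 k4 y0 y1 y2 gy0 gy1 gy2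
  -- more identities on `S`
  have m1 : (1 + U + V) * (bK - y0) = bK * (1 + U + V) - (aK + bK * U + cK * V) := by
    linear_combination - gy0
  have m2 : (1 + U + V) * (y0 - cK) = (aK + bK * U + cK * V) - cK * (1 + U + V) := by
    linear_combination gy0
  have m3 : (1 + U + V) * (y0 - aK) = (aK + bK * U + cK * V) - aK * (1 + U + V) := by
    linear_combination gy0
  have n1 : bK - y0 ≠ 0 := right_ne_zero_of_mul (m1 ▸ k3)
  have n2 : y0 - cK ≠ 0 := right_ne_zero_of_mul (m2 ▸ k2)
  have n3 : y0 - aK ≠ 0 := right_ne_zero_of_mul (m3 ▸ k4)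
  have f2 : (y0 - cK) * V = (y0 - aK) * y1 := by
    apply mul_left_cancel₀ k1
    linear_combination V * m2 - y1 * m3 - gy1
  have f1 : (bK - y0) * U = (y0 - aK) * (y1 + 1) := by
    linear_combination f2 - gy0
  have f3 : (y0 - cK) * (bK - aK) + (y0 - aK) * y1 * (bK - cK) =
      (bK - y0) * (y0 - cK) * (1 + U + V) := by
    linear_combination - (y0 - cK) * f1 - (bK - y0) * f2
  have n4 : (y0 - cK) * (bK - aK) + (y0 - aK) * y1 * (bK - cK) ≠ 0 := by
    rw [f3]; exact mul_ne_zero (mul_ne_zero n1 n2) k1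
  have f0 : (bK - cK) * ((y0 - cK) * (bK - aK) + (y0 - aK) * y1 * (bK - cK)) * W =
      y2 * (y0 - aK) * (bK - y0) * (y0 - cK) := by
    rw [f3]
    have : (y0 - aK) * y2 = (bK - cK) * W * (1 + U + V) := by
      apply mul_left_cancel₀ k1
      linear_combination y2 * m3 + gy2
    linear_combination - (bK - y0) * (y0 - cK) * this
  -- more identities on `S₂`
  have r1 : (bL - z) * (z - cL) * (1 + x1 + x2) =
      (z - cL) * (bL - aL) + (z - aL) * t * (bL - cL) := by
    linear_combination (z - cL) * gx1 + (bL - z) * gx2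
  have q0 : (1 + x1 + x2) * z = aL + bL * x1 + cL * x2 := by
    linear_combination gx2 - gx1
  have q1 : ((aL + bL * x1 + cL * x2) - aL * (1 + x1 + x2)) * t =
      ((aL + bL * x1 + cL * x2) - cL * (1 + x1 + x2)) * x2 := by
    rw [← q0]
    linear_combination - (1 + x1 + x2) * gx2
  have q2 : ((aL + bL * x1 + cL * x2) - aL * (1 + x1 + x2)) * w =
      (bL - cL) * x0 * (1 + x1 + x2) ^ 2 := by
    rw [← q0]
    rw [← r1] at gx0
    apply mul_left_cancel₀ (mul_ne_zero l1 l2)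
    linear_combination - (1 + x1 + x2) * gx0
  obtain ⟨φ, -, hφ⟩ := main_equiv (pS a b c) (pS₂ a b c)
    ![x0, x1, x2] (by rw [aeval_pS]; exact hX)
    ![y0, y1, y2] (by rw [aeval_pS₂ a b c hbc]; exact hY)
    ![X 2 * (X 0 - C a) * (C b - X 0) * (X 0 - C c), (X 0 - C a) * (X 1 + 1), (X 0 - C a) * X 1]
    ![(C b - C c) * ((X 0 - C c) * (C b - C a) + (X 0 - C a) * X 1 * (C b - C c)), C b - X 0,
      X 0 - C c]
    ![v₁S a b c, (v₁S a b c - C c * u₁S) * X 2, (C b - C c) * X 0 * u₁S ^ 2]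
    ![u₁S, v₁S a b c - C a * u₁S, v₁S a b c - C a * u₁S]
    (by
      intro i
      fin_cases i
      · simpa using ⟨hbcK, n4⟩
      · simpa using n1
      · simpa using n2)
    (by
      intro i
      fin_cases i
      · simpa [clsHom_C] using gx0
      · simpa [clsHom_C] using gx1
      · simpa [clsHom_C] using gx2)
    (by
      intro i
      fin_cases i
      · simpa using f0
      · simpa using f1
      · simpa using f2)
    (by
      intro i
      fin_cases i
      · simpa [clsHom_C, u₁S, v₁S] using k1
      · simpa [clsHom_C, u₁S, v₁S] using k4
      · simpa [clsHom_C, u₁S, v₁S] using k4)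
    (by
      intro i
      fin_cases i
      · simpa [clsHom_C, u₁S, v₁S] using gy0
      · simpa [clsHom_C, u₁S, v₁S] using gy1
      · simpa [clsHom_C, u₁S, v₁S] using gy2)
    (by
      intro i
      fin_cases i
      · simpa [u₁S, v₁S] using q0
      · simpa [u₁S, v₁S] using q1
      · simpa [u₁S, v₁S] using q2)
  refine ⟨φ, ![y0, y1, y2], hφ, ?_⟩
  intro σ h0 h1 h2
  change σ W = (ω ^ 2 : ℂ) • W at h0
  change σ U = U at h1
  change σ V = V at h2
  have sa : σ aK = aK := σ.commutes a
  have sb : σ bK = bK := σ.commutes b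
  have sc : σ cK = cK := σ.commutes c
  refine ⟨?_, ?_, ?_⟩
  · simp only [Matrix.cons_val]
    simp only [hy0, map_div₀, map_mul, map_add, map_sub, map_one, h1, h2, sa, sb, sc]
  · simp only [Matrix.cons_val]
    simp only [hy1, map_div₀, map_mul, map_add, map_sub, map_one, h1, h2, sa, sb, sc]
  · simp only [Matrix.cons_val]
    simp only [hy2, map_div₀, map_mul, map_add, map_sub, map_one, map_pow, h0, h1, h2, sa, sb, sc,
      Algebra.smul_def]
    ring

/-- For pairwise distinct `a, b, c ∈ ℂ ∖ {0,1}`, the affine surfaces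
`S` and `S₂` are birationally equivalent: there is a `ℂ`-algebra isomorphism of their
function fields intertwining the order-3 automorphism `w ↦ ω²·w` of `Frac(S)` with the
order-3 automorphism `w₁ ↦ ω²·w₁` of `Frac(S₂)` (each fixing the remaining
coordinates). -/
theorem stmt14 (a b c : ℂ) (ha0 : a ≠ 0) (ha1 : a ≠ 1) (hb0 : b ≠ 0) (hb1 : b ≠ 1)
    (hc0 : c ≠ 0) (hc1 : c ≠ 1) (hab : a ≠ b) (hac : a ≠ c) (hbc : b ≠ c) :
    ∃ (φ : FractionRing (HSurf (pS a b c)) ≃ₐ[ℂ] FractionRing (HSurf (pS₂ a b c)))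
      (σ : FractionRing (HSurf (pS a b c)) ≃ₐ[ℂ] FractionRing (HSurf (pS a b c)))
      (σ₂ : FractionRing (HSurf (pS₂ a b c)) ≃ₐ[ℂ] FractionRing (HSurf (pS₂ a b c))),
      orderOf σ = 3 ∧
      σ (cls (pS a b c) (X 0)) = (ω ^ 2 : ℂ) • cls (pS a b c) (X 0) ∧
      σ (cls (pS a b c) (X 1)) = cls (pS a b c) (X 1) ∧
      σ (cls (pS a b c) (X 2)) = cls (pS a b c) (X 2) ∧
      orderOf σ₂ = 3 ∧
      σ₂ (cls (pS₂ a b c) (X 2)) = (ω ^ 2 : ℂ) • cls (pS₂ a b c) (X 2) ∧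
      σ₂ (cls (pS₂ a b c) (X 0)) = cls (pS₂ a b c) (X 0) ∧
      σ₂ (cls (pS₂ a b c) (X 1)) = cls (pS₂ a b c) (X 1) ∧
      ∀ k, φ (σ k) = σ₂ (φ k) := by
  obtain ⟨z, hz⟩ := Infinite.exists_notMem_finset ({0, 1, a, b, c} : Finset ℂ)
  simp only [Finset.mem_insert, Finset.mem_singleton, not_or] at hz
  obtain ⟨hz0, hz1, hza, hzb, hzc⟩ := hz
  have : IsDomain (HSurf (pS a b c)) := isDomain_of_prime _ (prime_pS a b c ha0 ha1)
  have : IsDomain (HSurf (pS₂ a b c)) := isDomain_of_prime _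
    (prime_pS₂ a b c hbc z hz0 hz1 hza hzb hzc)
  have hX : cls (pS a b c) (X 0) ≠ 0 :=
    cls_ne_zero _ _ ![1, 0, -1] (by simp [pS, u₁S, v₁S]) (by simp)
  obtain ⟨σ, s0, s1, s2⟩ := sigma_exists a b c
  obtain ⟨φ, y, hφ, hσ⟩ := phi_exists a b c hab hac hbc
  obtain ⟨t0, t1, t2⟩ := hσ σ s0 s1 s2
  have hφ' (i) : φ.symm (cls (pS₂ a b c) (X i)) = y i := by
    rw [← hφ, AlgEquiv.symm_apply_apply]
  have ho := sigma_order a b c σ s0 s1 s2 hX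
  have hc (k) : AlgEquiv.autCongr φ σ k = φ (σ (φ.symm k)) := rfl
  refine ⟨φ, σ, AlgEquiv.autCongr φ σ, ho, s0, s1, s2, ?_, ?_, ?_, ?_, ?_⟩
  · rw [MulEquiv.orderOf_eq, ho]
  · rw [hc, hφ', t2, map_smul, hφ]
  · rw [hc, hφ', t0, hφ]
  · rw [hc, hφ', t1, hφ]
  · intro k
    rw [hc, AlgEquiv.symm_apply_apply]
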